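/- Let n ≥ 2, let d, a, k be positive integers, and suppose the triple (n,d,a) is bad. Then each of the triples (n, kd, a), (kn, d, a), and (kn, kd, ka) is also bad. -/

import Mathlib

open MvPolynomial

/-- A sequence of polynomials is a regular sequence if each element is a
nonzerodivisor modulo the ideal generated by the previous ones. -/
def RegSeq {n : ℕ} (fs : List (MvPolynomial (Fin n) ℂ)) : Prop :=
  ∀ i : Fin fs.length, ∀ g : MvPolynomial (Fin n) ℂ,
    g * fs.get i ∈ Ideal.span {p | p ∈ fs.take i.1} →
    g ∈ Ideal.span {p | p ∈ fs.take i.1}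

/-- The sequence `x_1^d - x_n^d, …, x_{n-1}^d - x_n^d` in `ℂ[x_1,…,x_n]`. -/
noncomputable def powDiffSeq (n d : ℕ) : List (MvPolynomial (Fin n) ℂ) :=
  (List.finRange (n - 1)).map fun i =>
    X (⟨i.1, by have := i.isLt; omega⟩ : Fin n) ^ d -
    X (⟨n - 1, by have := i.isLt; omega⟩ : Fin n) ^ d

/-- The triple `(n,d,a)` is good if there is a homogeneous symmetric polynomial `f`
of degree `a` such that `x_1^d - x_n^d, …, x_{n-1}^d - x_n^d, f` is a regular
sequence. -/
def GoodTriple (n d a : ℕ) : Prop :=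
  ∃ f : MvPolynomial (Fin n) ℂ, f.IsHomogeneous a ∧ f.IsSymmetric ∧
    RegSeq (powDiffSeq n d ++ [f])

namespace MvPolynomial

variable {σ R S : Type*}

theorem IsHomogeneous.aeval_mul_left [CommSemiring R] [CommSemiring S] [Algebra R S]
    {f : MvPolynomial σ R} {a : ℕ} (hf : f.IsHomogeneous a) (r : S) (g : σ → S) :
    MvPolynomial.aeval (fun i => r * g i) f = r ^ a * MvPolynomial.aeval g f := by
  rw [aeval_def, aeval_def, eval₂_eq, eval₂_eq, Finset.mul_sum]
  refine Finset.sum_congr rfl fun m hm => ?_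
  have hdeg : ∑ i ∈ m.support, m i = a := by
    simpa [Finsupp.weight_apply, Finsupp.sum] using hf (mem_support_iff.mp hm)
  simp_rw [mul_pow]
  rw [Finset.prod_mul_distrib, Finset.prod_pow_eq_pow_sum, hdeg]
  ring

theorem coeff_aeval_C_mul_X [Fintype σ] [CommSemiring R] (c : σ → R) (f : MvPolynomial σ R)
    (m : σ →₀ ℕ) :
    coeff m (aeval (fun i => C (c i) * X i) f) = (∏ i, c i ^ m i) * coeff m f := by
  classical
  induction f using MvPolynomial.induction_on' with
  | monomial u a =>
    have h : aeval (fun i => C (c i) * X i) (monomial u a) =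
        monomial u ((∏ i, c i ^ u i) * a) := by
      rw [aeval_monomial, Finsupp.prod_fintype _ _ (fun i => pow_zero _)]
      simp_rw [mul_pow]
      rw [Finset.prod_mul_distrib, algebraMap_eq, monomial_eq (s := u),
        Finsupp.prod_fintype _ _ (fun i => pow_zero _), C_mul, map_prod]
      simp_rw [C_pow]
      ring
    rw [h, coeff_monomial, coeff_monomial]
    split_ifs with hu
    · rw [hu]
    · rw [mul_zero]
  | add p q hp hq => rw [map_add, coeff_add, hp, hq, coeff_add, mul_add]

theorem exists_expand_eq [CommSemiring R] {k : ℕ} {F : MvPolynomial σ R}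
    (h : ∀ m ∈ F.support, ∀ i, k ∣ m i) : ∃ g, expand k g = F := by
  refine ⟨∑ m ∈ F.support, monomial (m.mapRange (· / k) (Nat.zero_div k)) (coeff m F), ?_⟩
  rw [map_sum]
  conv_rhs => rw [F.as_sum]
  refine Finset.sum_congr rfl fun m hm => ?_
  have hm' : k • m.mapRange (· / k) (Nat.zero_div k) = m := by
    ext i
    simpa using Nat.mul_div_cancel' (h m hm i)
  rw [expand_monomial, hm']

theorem IsHomogeneous.of_expand [CommSemiring R] {k a : ℕ} (hk : 0 < k) {g : MvPolynomial σ R}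
    (h : (expand k g).IsHomogeneous (k * a)) : g.IsHomogeneous a := by
  intro m hm
  have := h (d := k • m) (by rwa [coeff_expand_smul _ hk.ne'])
  rw [map_nsmul, smul_eq_mul] at this
  exact Nat.eq_of_mul_eq_mul_left hk this

theorem IsSymmetric.of_expand [CommSemiring R] {k : ℕ} (hk : 0 < k) {g : MvPolynomial σ R}
    (h : (expand k g).IsSymmetric) : g.IsSymmetric := fun e => by
  apply expand_injective hk
  rw [← rename_expand, h e]

/-- The ideal generated by `x_j^d - x_l^d` for `j ∈ J`. -/
noncomputable def powDiffIdeal (d : ℕ) (l : σ) (J : Set σ) : Ideal (MvPolynomial σ ℂ) :=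
  Ideal.span ((fun j => X j ^ d - X l ^ d) '' J)

theorem aeval_eq_zero_of_mem_powDiffIdeal [CommRing S] [Algebra ℂ S] {d : ℕ} {l : σ} {J : Set σ}
    {g : MvPolynomial σ ℂ} (hg : g ∈ powDiffIdeal d l J) {z : σ → S}
    (hz : ∀ j ∈ J, z j ^ d = z l ^ d) : aeval z g = 0 := by
  have : powDiffIdeal d l J ≤ RingHom.ker (aeval (R := ℂ) z) := by
    refine Ideal.span_le.mpr ?_
    rintro _ ⟨j, hj, rfl⟩
    simp [RingHom.mem_ker, hz j hj]
  exact this hg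

theorem X_pow_sub_X_pow_eq_prod {d : ℕ} (hd : 0 < d) (x y : MvPolynomial σ ℂ) :
    x ^ d - y ^ d = ∏ ζ ∈ Polynomial.nthRootsFinset d (1 : MvPolynomial σ ℂ), (x - ζ * y) :=
  ((Complex.isPrimitiveRoot_exp d hd.ne').map_of_injective
    (C_injective σ ℂ)).pow_sub_pow_eq_prod_sub_mul x y hd

/-- A polynomial killed by all substitutions `x_j ↦ ζ_j x_l` (`j ∈ J`, `ζ_j ^ d = 1`) lies in the
ideal generated by the `x_j^d - x_l^d`. -/
theorem mem_powDiffIdeal [Finite σ] {d : ℕ} (hd : 0 < d) {l : σ} {J : Set σ}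
    {g : MvPolynomial σ ℂ}
    (hg : ∀ z : σ → MvPolynomial σ ℂ, (∀ j ∈ J, z j ^ d = X l ^ d) →
      (∀ j ∉ J, z j = X j) → aeval z g = 0) :
    g ∈ powDiffIdeal d l J := by
  classical
  let T : Finset (MvPolynomial σ ℂ) :=
    (Polynomial.nthRootsFinset d (1 : MvPolynomial σ ℂ)).image (· * X l)
  let S : σ → Finset (MvPolynomial σ ℂ) := fun j => if j ∈ J then T else {X j}
  have hS : ∀ j, (S j).Nonempty := fun j => by
    by_cases hj : j ∈ J
    · simp only [S, if_pos hj, T]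
      exact ⟨_, Finset.mem_image_of_mem _ ((Polynomial.mem_nthRootsFinset hd 1).2 (one_pow d))⟩
    · simp [S, hj]
  obtain ⟨h, -, hh⟩ := combinatorial_nullstellensatz_exists_linearCombination S hS (map C g)
    (fun z hz => by
      rw [eval_map]
      refine hg z (fun j hj => ?_) (fun j hj => ?_)
      · have := hz j
        simp only [S, if_pos hj, T, Finset.mem_image] at this
        obtain ⟨ζ, hζ, hζz⟩ := this
        rw [← hζz, mul_pow, (Polynomial.mem_nthRootsFinset hd 1).1 hζ, one_mul]
      · simpa [S, hj] using hz j)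
  have hX := congrArg (eval (X : σ → MvPolynomial σ ℂ)) hh
  rw [eval_map, eval₂_eta, Finsupp.linearCombination_apply, Finsupp.sum, map_sum] at hX
  rw [hX]
  refine Ideal.sum_mem _ fun j _ => ?_
  rw [smul_eq_mul, map_mul, map_prod]
  refine Ideal.mul_mem_left _ _ ?_
  simp only [map_sub, eval_X, eval_C]
  by_cases hj : j ∈ J
  · have : ∏ r ∈ S j, (X j - r) = (X j ^ d - X l ^ d : MvPolynomial σ ℂ) := by
      rw [X_pow_sub_X_pow_eq_prod hd]
      simp only [S, if_pos hj, T]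
      rw [Finset.prod_image]
      exact fun a _ b _ hab => mul_right_cancel₀ (X_ne_zero l) hab
    rw [this]
    exact Ideal.subset_span ⟨j, hj, rfl⟩
  · simp [S, hj]

theorem mem_powDiffIdeal_of_mul_mem [Finite σ] {d : ℕ} (hd : 0 < d) {l : σ} {J : Set σ}
    (hl : l ∉ J) {f g : MvPolynomial σ ℂ}
    (hf : ∀ z : σ → MvPolynomial σ ℂ, (∀ j ∈ J, z j ^ d = X l ^ d) →
      (∀ j ∉ J, z j = X j) → aeval z f ≠ 0)
    (hgf : g * f ∈ powDiffIdeal d l J) : g ∈ powDiffIdeal d l J := by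
  refine mem_powDiffIdeal hd fun z hz hz' => ?_
  have := aeval_eq_zero_of_mem_powDiffIdeal hgf (z := z) (by simpa [hz' l hl] using hz)
  rw [map_mul] at this
  exact (mul_eq_zero.mp this).resolve_right (hf z hz hz')

/-- A homogeneous nonzerodivisor modulo all the `x_j^d - x_l^d` does not vanish at any point
whose coordinates are `d`-th roots of unity. -/
theorem eval_ne_zero_of_mul_mem [Fintype σ] {d a : ℕ} (hd : 0 < d) {l : σ}
    {f : MvPolynomial σ ℂ} (hfa : f.IsHomogeneous a)
    (hf : ∀ g, g * f ∈ powDiffIdeal d l {l}ᶜ → g ∈ powDiffIdeal d l {l}ᶜ)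
    {z : σ → ℂ} (hz : ∀ i, z i ^ d = 1) : eval z f ≠ 0 := by
  classical
  intro h0
  have hz0 : ∀ i, z i ≠ 0 := fun i hi => by simpa [hi, hd.ne'] using hz i
  let c : σ → ℂ := fun i => (z l)⁻¹ * z i
  have hc : ∀ i, c i ^ d = 1 := fun i => by simp [c, mul_pow, hz]
  have hcl : c l = 1 := inv_mul_cancel₀ (hz0 l)
  have hfc : eval c f = 0 := by
    have := hfa.aeval_mul_left (z l)⁻¹ z
    rw [aeval_eq_eval, aeval_eq_eval, h0, mul_zero] at this
    exact this
  let g : MvPolynomial σ ℂ := ∏ j ∈ Finset.univ.erase l,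
    ∑ i ∈ Finset.range d, X j ^ i * (C (c j) * X l) ^ (d - 1 - i)
  have hg : g ∈ powDiffIdeal d l {l}ᶜ := by
    refine hf g (mem_powDiffIdeal hd fun w hw hw' => ?_)
    have hwl : w l = X l := hw' l (by simp)
    rw [map_mul]
    by_cases hwc : ∀ j, w j = X l * C (c j)
    · have : aeval w f = 0 := by
        rw [_root_.funext hwc, hfa.aeval_mul_left]
        have : aeval (fun j => (C (c j) : MvPolynomial σ ℂ)) f = C (eval c f) := by
          rw [eval, coe_eval₂Hom, eval₂_comp_left C, RingHom.comp_id, aeval_def, algebraMap_eq]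
          rfl
        rw [this, hfc, C_0, mul_zero]
      rw [this, mul_zero]
    · push Not at hwc
      obtain ⟨j, hj⟩ := hwc
      have hjl : j ≠ l := fun h => hj (by rw [h, hwl, hcl, C_1, mul_one])
      have hj0 : aeval w (∑ i ∈ Finset.range d, X j ^ i * (C (c j) * X l) ^ (d - 1 - i)) = 0 := by
        have := (Commute.all (w j) (C (c j) * X l)).geom_sum₂_mul d
        rw [hw j hjl, mul_pow, ← C_pow, hc, C_1, one_mul, sub_self] at this
        have h2 := (mul_eq_zero.mp this).resolve_right (by
          rw [sub_eq_zero, mul_comm]; exact hj)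
        simpa [hwl, algebraMap_eq] using h2
      have : aeval w g = 0 := by
        simp only [g]
        rw [map_prod]
        exact Finset.prod_eq_zero (Finset.mem_erase.mpr ⟨hjl, Finset.mem_univ j⟩) hj0
      rw [this, zero_mul]
  have hgc := aeval_eq_zero_of_mem_powDiffIdeal hg (z := c) (by simp [hc])
  simp only [g] at hgc
  rw [map_prod, Finset.prod_eq_zero_iff] at hgc
  obtain ⟨j, -, hj⟩ := hgc
  have hcj : c j ≠ 0 := mul_ne_zero (inv_ne_zero (hz0 l)) (hz0 j)
  have : ∑ i ∈ Finset.range d, c j ^ i * c j ^ (d - 1 - i) = d * c j ^ (d - 1) := by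
    rw [Finset.sum_congr rfl (g := fun _ => c j ^ (d - 1)), Finset.sum_const, Finset.card_range,
      nsmul_eq_mul]
    intro i hi
    rw [← pow_add]
    congr 1
    have := Finset.mem_range.mp hi
    omega
  simp [hcl, this, hcj, hd.ne'] at hj

end MvPolynomial

theorem span_take_powDiffSeq {n d i : ℕ} (hn : 0 < n) (hi : i ≤ n - 1)
    (f : MvPolynomial (Fin n) ℂ) :
    Ideal.span {p | p ∈ (powDiffSeq n d ++ [f]).take i} =
      powDiffIdeal d (⟨n - 1, by omega⟩ : Fin n) {j | j.1 < i} := by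
  have hlen : (powDiffSeq n d).length = n - 1 := by simp [powDiffSeq]
  rw [List.take_append_of_le_length (by omega), powDiffIdeal]
  congr 1
  ext p
  simp only [Set.mem_ofPred_eq, List.mem_take_iff_getElem, Set.mem_image]
  constructor
  · rintro ⟨j, hj, rfl⟩
    exact ⟨⟨j, by omega⟩, by simp; omega, by simp [powDiffSeq]⟩
  · rintro ⟨j, hj, rfl⟩
    exact ⟨j, by omega, by simp [powDiffSeq]⟩

theorem goodTriple_iff {n d a : ℕ} (hn : 0 < n) (hd : 0 < d) :
    GoodTriple n d a ↔ ∃ f : MvPolynomial (Fin n) ℂ, f.IsHomogeneous a ∧ f.IsSymmetric ∧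
      ∀ z : Fin n → ℂ, (∀ i, z i ^ d = 1) → eval z f ≠ 0 := by
  have hlen : (powDiffSeq n d).length = n - 1 := by simp [powDiffSeq]
  have hcompl : {j : Fin n | j.1 < n - 1} = {(⟨n - 1, by omega⟩ : Fin n)}ᶜ := by
    ext j
    simp only [Set.mem_ofPred_eq, Set.mem_compl_iff, Set.mem_singleton_iff, Fin.ext_iff]
    omega
  refine exists_congr fun f => and_congr_right fun hfa => and_congr_right fun _ => ⟨?_, ?_⟩
  · intro hreg z hz
    refine eval_ne_zero_of_mul_mem hd (l := ⟨n - 1, by omega⟩) hfa (fun g hg => ?_) hz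
    have := hreg ⟨n - 1, by simp [hlen]⟩ g
    rw [span_take_powDiffSeq hn le_rfl, hcompl] at this
    exact this (by simpa [hlen] using hg)
  · intro hf i g
    have hi : i.1 ≤ n - 1 := by
      have := i.2
      simp [hlen] at this
      omega
    rw [span_take_powDiffSeq hn hi]
    refine mem_powDiffIdeal_of_mul_mem hd (by simpa using hi) fun z hz hz' => ?_
    rcases hi.lt_or_eq with hlt | heq
    · have : (powDiffSeq n d ++ [f]).get i =
          X ⟨i.1, by omega⟩ ^ d - X ⟨n - 1, by omega⟩ ^ d := by
        rw [List.get_eq_getElem, List.getElem_append_left (by omega)]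
        simp [powDiffSeq]
      rw [this]
      simp only [map_sub, map_pow, aeval_X]
      rw [hz' ⟨i.1, by omega⟩ (by simp), hz' ⟨n - 1, by omega⟩ (by simpa using hi)]
      intro h
      have := congrArg (eval fun j : Fin n => if j.1 = n - 1 then (1 : ℂ) else 0) h
      simp [hlt.ne, hd.ne'] at this
    · have : (powDiffSeq n d ++ [f]).get i = f := by
        rw [List.get_eq_getElem, List.getElem_append_right (by omega)]
        simp
      rw [this]
      intro h
      have h1 := congrArg (eval fun _ => (1 : ℂ)) h
      rw [map_zero, aeval_def, eval₂_comp_left (eval fun _ => (1 : ℂ))] at h1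
      have hid : (eval fun _ : Fin n => (1 : ℂ)).comp (algebraMap ℂ (MvPolynomial (Fin n) ℂ)) =
          RingHom.id ℂ := by
        ext; simp [algebraMap_eq]
      rw [hid] at h1
      refine hf _ (fun j => ?_) h1
      rw [Function.comp_apply, ← map_pow]
      by_cases hj : j.1 < i.1
      · rw [hz j hj]
        simp
      · rw [hz' j hj]
        simp

theorem GoodTriple.of_mul_exponent {n d a k : ℕ} (hn : 0 < n) (hd : 0 < d) (hk : 0 < k)
    (h : GoodTriple n (k * d) a) : GoodTriple n d a := by
  rw [goodTriple_iff hn (by positivity)] at h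
  rw [goodTriple_iff hn hd]
  obtain ⟨f, hfa, hfs, hf⟩ := h
  exact ⟨f, hfa, hfs, fun z hz => hf z fun i => by rw [mul_comm, pow_mul, hz, one_pow]⟩

theorem goodTriple_mul_iff {n d a k : ℕ} (hn : 0 < n) (hd : 0 < d) (hk : 0 < k) :
    GoodTriple (k * n) d a ↔ ∃ f : MvPolynomial (Fin n × Fin k) ℂ, f.IsHomogeneous a ∧
      f.IsSymmetric ∧ ∀ z : Fin n × Fin k → ℂ, (∀ i, z i ^ d = 1) → eval z f ≠ 0 := by
  rw [goodTriple_iff (by positivity) hd]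
  let e : Fin (k * n) ≃ Fin n × Fin k := finProdFinEquiv.symm.trans (Equiv.prodComm _ _)
  constructor
  · rintro ⟨f, hfa, hfs, hf⟩
    refine ⟨rename e f, hfa.rename_isHomogeneous, hfs.rename e, fun z hz => ?_⟩
    rw [eval_rename]
    exact hf _ fun i => hz _
  · rintro ⟨f, hfa, hfs, hf⟩
    refine ⟨rename e.symm f, hfa.rename_isHomogeneous, hfs.rename e.symm, fun z hz => ?_⟩
    rw [eval_rename]
    exact hf _ fun i => hz _

theorem GoodTriple.of_mul_variables {n d a k : ℕ} (hn : 0 < n) (hd : 0 < d) (hk : 0 < k)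
    (h : GoodTriple (k * n) d a) : GoodTriple n d a := by
  rw [goodTriple_mul_iff hn hd hk] at h
  rw [goodTriple_iff hn hd]
  obtain ⟨f, hfa, hfs, hf⟩ := h
  refine ⟨rename Prod.fst f, hfa.rename_isHomogeneous, fun s => ?_, fun z hz => ?_⟩
  · conv_rhs => rw [← hfs (Equiv.prodCongr s (Equiv.refl _))]
    rw [rename_rename, rename_rename]
    rfl
  · rw [eval_rename]
    exact hf _ fun i => hz _

theorem GoodTriple.of_mul {n d a k : ℕ} (hn : 0 < n) (hd : 0 < d) (hk : 0 < k)
    (h : GoodTriple (k * n) (k * d) (k * a)) : GoodTriple n d a := by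
  rw [goodTriple_mul_iff hn (by positivity) hk] at h
  rw [goodTriple_iff hn hd]
  obtain ⟨f, hfa, hfs, hf⟩ := h
  have : NeZero k := ⟨hk.ne'⟩
  obtain ⟨ω, hω⟩ : ∃ ω : ℂ, IsPrimitiveRoot ω k := ⟨_, Complex.isPrimitiveRoot_exp k hk.ne'⟩
  have hωsucc : ∀ j : Fin k, ω ^ (j + 1 : Fin k).1 = ω ^ j.1 * ω := fun j => by
    rw [← pow_succ, Fin.val_add, Fin.coe_ofNat_eq_mod, Nat.add_mod_mod,
      ← pow_mod_orderOf ω (j.1 + 1), ← hω.eq_orderOf]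
  obtain ⟨F, hF⟩ : ∃ F : MvPolynomial (Fin n) ℂ,
      F = aeval (fun p => C (ω ^ p.2.1) * X p.1) f := ⟨_, rfl⟩
  have hFa : F.IsHomogeneous (k * a) := by
    rw [hF, ← one_mul (k * a)]
    refine hfa.aeval _ fun p => ?_
    rw [← zero_add 1]
    exact (isHomogeneous_C _ _).mul (isHomogeneous_X _ _)
  have hFs : F.IsSymmetric := fun s => by
    rw [hF]
    conv_rhs => rw [← hfs (Equiv.prodCongr s (Equiv.refl _))]
    rw [aeval_rename, ← AlgHom.comp_apply, comp_aeval]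
    congr 2
    ext p
    simp
  have hFscale : ∀ i₀ : Fin n,
      aeval (fun i => C (if i = i₀ then ω else 1) * X i : Fin n → MvPolynomial (Fin n) ℂ) F = F :=
    fun i₀ => by
      rw [hF]
      conv_rhs => rw [← hfs (Equiv.prodShear (Equiv.refl _)
        fun i => if i = i₀ then Equiv.addRight 1 else Equiv.refl _)]
      rw [aeval_rename, ← AlgHom.comp_apply, comp_aeval]
      congr 2
      ext1 p
      by_cases hp : p.1 = i₀
      · have : (C ω ^ (p.2 + 1 : Fin k).1 : MvPolynomial (Fin n) ℂ) = C ω ^ p.2.1 * C ω := by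
          rw [← C_pow, hωsucc, C_mul, C_pow]
        simp [hp, this, algebraMap_eq, mul_assoc]
      · simp [hp, algebraMap_eq]
  have hdvd : ∀ m ∈ F.support, ∀ i, k ∣ m i := fun m hm i => by
    have h1 := coeff_aeval_C_mul_X (fun j => if j = i then ω else 1) F m
    rw [hFscale i] at h1
    have h2 := mul_right_cancel₀ (mem_support_iff.mp hm) ((one_mul _).trans h1)
    refine hω.dvd_of_pow_eq_one _ ?_
    rw [h2, Finset.prod_eq_single i (fun j _ hj => by simp [hj]) (by simp)]
    simp
  obtain ⟨g, hg⟩ := exists_expand_eq hdvd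
  rw [← hg] at hFa hFs
  refine ⟨g, hFa.of_expand hk, hFs.of_expand hk, fun z hz => ?_⟩
  choose y hy using fun i => IsAlgClosed.exists_pow_nat_eq (z i) hk
  have hyz : eval z g = eval (fun p : Fin n × Fin k => ω ^ p.2.1 * y p.1) f := by
    have : z = y ^ k := funext fun i => (hy i).symm
    rw [this, ← eval_expand, hg, hF, ← aeval_eq_eval, ← aeval_eq_eval, ← AlgHom.comp_apply,
      comp_aeval]
    simp
  rw [hyz]
  refine hf _ fun p => ?_
  rw [mul_pow, pow_mul (y p.1), hy, hz, mul_one, ← pow_mul, mul_left_comm, pow_mul,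
    hω.pow_eq_one, one_pow]

theorem inc_bad (n d a k : ℕ) (hn : 2 ≤ n) (hd : 0 < d) (ha : 0 < a) (hk : 0 < k)
    (hbad : ¬ GoodTriple n d a) :
    ¬ GoodTriple n (k * d) a ∧ ¬ GoodTriple (k * n) d a ∧
      ¬ GoodTriple (k * n) (k * d) (k * a) :=
  have hn' : 0 < n := by omega
  ⟨fun h => hbad (h.of_mul_exponent hn' hd hk), fun h => hbad (h.of_mul_variables hn' hd hk),
    fun h => hbad (h.of_mul hn' hd hk)⟩
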